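/- arXiv:2605.13888 — 4 statements merged into one kernel-verified Lean document; each statement's English description precedes it below -/
import Mathlib

section
/- Let K be a number field and let u ∈ Kˣ be an element that is not a square in K. Then there exists a nonzero prime ideal v of the ring of integers of K such that the image of u in the v-adic completion K_v is not a square in K_v. -/
open IsDedekindDomain NumberField

lemma Multiset.eq_of_map_add_map_eq {α β : Type*} {f g : α → β} {r : β → α} {s : Set α}
    (hf : ∀ a ∈ s, r (f a) = a) (hg : ∀ a ∈ s, r (g a) = a) (hfg : ∀ a ∈ s, f a ≠ g a)
    {A B A' B' : Multiset α} (hA : ∀ a ∈ A, a ∈ s) (hB : ∀ a ∈ B, a ∈ s)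
    (hA' : ∀ a ∈ A', a ∈ s) (hB' : ∀ a ∈ B', a ∈ s)
    (h : A.map f + B.map g = A'.map f + B'.map g) : A = A' ∧ B = B' := by
  classical
  have key (A B : Multiset α) (hA : ∀ a ∈ A, a ∈ s) (hB : ∀ a ∈ B, a ∈ s) :
      ((A.map f + B.map g).filter fun b ↦ f (r b) = b).map r = A ∧
      ((A.map f + B.map g).filter fun b ↦ ¬ f (r b) = b).map r = B := by
    have h1 : ∀ b ∈ A.map f, f (r b) = b := by
      simp only [Multiset.mem_map]
      rintro _ ⟨a, ha, rfl⟩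
      rw [hf a (hA a ha)]
    have h2 : ∀ b ∈ B.map g, ¬ f (r b) = b := by
      simp only [Multiset.mem_map]
      rintro _ ⟨a, ha, rfl⟩
      rw [hg a (hB a ha)]
      exact hfg a (hB a ha)
    have h3 : (A.map f).map r = A := by
      rw [Multiset.map_map]
      exact (Multiset.map_congr rfl fun a ha ↦ hf a (hA a ha)).trans (Multiset.map_id A)
    have h4 : (B.map g).map r = B := by
      rw [Multiset.map_map]
      exact (Multiset.map_congr rfl fun a ha ↦ hg a (hB a ha)).trans (Multiset.map_id B)
    rw [Multiset.filter_add, Multiset.filter_add, Multiset.filter_eq_self.mpr h1,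
      Multiset.filter_eq_nil.mpr h2, Multiset.filter_eq_self.mpr h2,
      Multiset.filter_eq_nil.mpr fun b hb ↦ not_not.mpr (h1 b hb), add_zero, zero_add]
    exact ⟨h3, h4⟩
  exact ⟨by rw [← (key A B hA hB).1, h, (key A' B' hA' hB').1],
    by rw [← (key A B hA hB).2, h, (key A' B' hA' hB').2]⟩

namespace IsDedekindDomain.HeightOneSpectrum

lemma exists_valued_algebraMap_sub_lt {R K : Type*} [CommRing R] [IsDedekindDomain R] [Field K]
    [Algebra R K] [IsFractionRing R K] (v : HeightOneSpectrum R) (y : v.adicCompletion K)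
    {z : v.adicCompletion K} (hz : z ≠ 0) :
    ∃ a : K, Valued.v (algebraMap K (v.adicCompletion K) a - y) < Valued.v z := by
  have hU : {x : v.adicCompletion K | Valued.v (x - y) < Valued.v z} ∈ nhds y := by
    rw [Valued.mem_nhds]
    refine ⟨Units.mk0 (Valued.v.restrict z) (by simpa using hz), fun x hx ↦ ?_⟩
    simpa using hx
  obtain ⟨a, ha⟩ := (denseRange_algebraMap K v).exists_mem_open isOpen_interior
    ⟨y, mem_interior_iff_mem_nhds.mpr hU⟩
  refine ⟨a, ?_⟩
  simpa using interior_subset ha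

variable {K : Type*} [Field K] [NumberField K] {v : HeightOneSpectrum (𝓞 K)}
variable {L : Type*} [Field L] [Algebra K L]

/-- The restriction to rings of integers of an embedding of `L` in a completion of `K`. -/
noncomputable def integersHom (τ : L →ₐ[K] v.adicCompletion K) :
    𝓞 L →+* v.adicCompletionIntegers K :=
  (τ.toRingHom.comp (algebraMap (𝓞 L) L)).codRestrict (v.adicCompletionIntegers K) fun x ↦ by
    have hx : IsIntegral (v.adicCompletionIntegers K) (τ (algebraMap (𝓞 L) L x)) := by
      have h : IsIntegral (𝓞 K) (τ (algebraMap (𝓞 L) L x)) :=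
        (RingOfIntegers.isIntegral_coe x).tower_top.map (τ.restrictScalars (𝓞 K))
      have : IsScalarTower (𝓞 K) (v.adicCompletionIntegers K) (v.adicCompletion K) :=
        .of_algebraMap_eq fun _ ↦ rfl
      exact h.tower_top
    obtain ⟨y, hy⟩ := IsIntegrallyClosed.isIntegral_iff.mp hx
    exact hy ▸ y.2

@[simp]
lemma coe_integersHom (τ : L →ₐ[K] v.adicCompletion K) (x : 𝓞 L) :
    (integersHom τ x : v.adicCompletion K) = τ (algebraMap (𝓞 L) L x) := rfl

/-- The prime ideal of `𝓞 L` induced by an embedding of `L` in a completion of `K`. -/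
noncomputable def primeOfHom (τ : L →ₐ[K] v.adicCompletion K) : Ideal (𝓞 L) :=
  (IsLocalRing.maximalIdeal (v.adicCompletionIntegers K)).comap (integersHom τ)

instance (τ : L →ₐ[K] v.adicCompletion K) : (primeOfHom τ).IsPrime :=
  inferInstanceAs (Ideal.comap _ _).IsPrime

lemma mem_primeOfHom {τ : L →ₐ[K] v.adicCompletion K} {x : 𝓞 L} :
    x ∈ primeOfHom τ ↔ Valued.v (τ (algebraMap (𝓞 L) L x)) < 1 := by
  rw [primeOfHom, Ideal.mem_comap, ← coe_integersHom]
  rw [IsLocalRing.mem_maximalIdeal, mem_nonunits_iff,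
    adicCompletionIntegers.isUnit_iff_valued_eq_one]
  exact (lt_iff_le_and_ne.trans (and_iff_right (integersHom τ x).2)).symm

lemma valued_hom_le_one (τ : L →ₐ[K] v.adicCompletion K) (x : 𝓞 L) :
    Valued.v (τ (algebraMap (𝓞 L) L x)) ≤ 1 := (integersHom τ x).2

lemma comap_primeOfHom (τ : L →ₐ[K] v.adicCompletion K) :
    (primeOfHom τ).comap (algebraMap (𝓞 K) (𝓞 L)) = v.asIdeal := by
  ext x
  rw [Ideal.mem_comap, mem_primeOfHom, ← valuation_lt_one_iff_mem (K := K),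
    ← valuedAdicCompletion_eq_valuation']
  rw [← IsScalarTower.algebraMap_apply, IsScalarTower.algebraMap_apply (𝓞 K) K L, τ.commutes]
  rfl

lemma absNorm_primeOfHom [NumberField L] (τ : L →ₐ[K] v.adicCompletion K) :
    (primeOfHom τ).absNorm = v.asIdeal.absNorm := by
  have hker : RingHom.ker ((Ideal.Quotient.mk (primeOfHom τ)).comp (algebraMap (𝓞 K) (𝓞 L)))
      = v.asIdeal := by
    rw [← RingHom.comap_ker, Ideal.mk_ker, comap_primeOfHom]
  have hsurj : Function.Surjective
      ((Ideal.Quotient.mk (primeOfHom τ)).comp (algebraMap (𝓞 K) (𝓞 L))) := by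
    intro y
    obtain ⟨x, rfl⟩ := Ideal.Quotient.mk_surjective y
    obtain ⟨a, ha⟩ := exists_valued_algebraMap_sub_lt v (τ (algebraMap (𝓞 L) L x)) one_ne_zero
    rw [map_one] at ha
    have hx := valued_hom_le_one τ x
    have ha1 : v.valuation K a ≤ 1 := by
      rw [← valuedAdicCompletion_eq_valuation']
      have := Valued.v.map_add (algebraMap K (v.adicCompletion K) a - τ (algebraMap (𝓞 L) L x))
        (τ (algebraMap (𝓞 L) L x))
      rw [sub_add_cancel] at this
      exact this.trans (max_le ha.le hx)
    obtain ⟨b, hb⟩ := exists_valuation_sub_lt_of_integer v ha1 1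
    refine ⟨b, ?_⟩
    rw [RingHom.comp_apply, Ideal.Quotient.eq, mem_primeOfHom]
    have h : τ (algebraMap (𝓞 L) L (algebraMap (𝓞 K) (𝓞 L) b - x)) =
        algebraMap K (v.adicCompletion K) (algebraMap (𝓞 K) K b - a) +
        (algebraMap K (v.adicCompletion K) a - τ (algebraMap (𝓞 L) L x)) := by
      rw [map_sub, map_sub, map_sub, ← IsScalarTower.algebraMap_apply,
        IsScalarTower.algebraMap_apply (𝓞 K) K L, τ.commutes]
      ring
    rw [h]
    refine (Valued.v.map_add _ _).trans_lt (max_lt ?_ ha)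
    exact (valuedAdicCompletion_eq_valuation' v _).trans_lt hb
  rw [Ideal.absNorm_apply, Ideal.absNorm_apply, Submodule.cardQuot_apply, Submodule.cardQuot_apply]
  exact (Nat.card_congr ((Ideal.quotEquivOfEq hker.symm).trans
    (RingHom.quotientKerEquivOfSurjective hsurj)).toEquiv).symm

lemma primeOfHom_ne_of_ne [NumberField L] {τ τ' : L →ₐ[K] v.adicCompletion K} (h : τ ≠ τ') :
    primeOfHom τ ≠ primeOfHom τ' := by
  intro heq
  obtain ⟨x, hx⟩ : ∃ x, τ x ≠ τ' x := by
    by_contra! H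
    exact h (AlgHom.ext H)
  obtain ⟨a, ha⟩ := exists_valued_algebraMap_sub_lt v (τ x) (sub_ne_zero.mpr hx)
  have ha' : Valued.v (algebraMap K (v.adicCompletion K) a - τ' x) = Valued.v (τ x - τ' x) := by
    rw [← sub_add_sub_cancel _ (τ x), add_comm]
    exact Valuation.map_add_eq_of_lt_left _ ha
  have hbot : primeOfHom τ ≠ ⊥ := by
    intro hb
    have h1 := comap_primeOfHom τ
    rw [hb, ← RingHom.ker_eq_comap_bot,
      (RingHom.injective_iff_ker_eq_bot _).mp (FaithfulSMul.algebraMap_injective (𝓞 K) (𝓞 L))] at h1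
    exact v.ne_bot h1.symm
  let w : HeightOneSpectrum (𝓞 L) := ⟨primeOfHom τ, inferInstance, hbot⟩
  set t : L := algebraMap K L a - x
  have ht : τ t = algebraMap K (v.adicCompletion K) a - τ x := by simp [t]
  have ht' : τ' t = algebraMap K (v.adicCompletion K) a - τ' x := by simp [t]
  have hlt : Valued.v (τ t) < Valued.v (τ' t) := by rw [ht, ht', ha']; exact ha
  obtain ⟨c, hc⟩ := v.valuation_surjective K (Valued.v (τ' t))
  have hc' : Valued.v (algebraMap K (v.adicCompletion K) c) = Valued.v (τ' t) :=
    (valuedAdicCompletion_eq_valuation' v c).trans hc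
  have hpos : 0 < Valued.v (τ' t) := zero_le.trans_lt hlt
  set z : L := t / algebraMap K L c
  have hz : Valued.v (τ z) < 1 := by
    rw [map_div₀, τ.commutes, map_div₀, hc']
    exact (div_lt_one₀ hpos).mpr hlt
  have hz' : Valued.v (τ' z) = 1 := by
    rw [map_div₀, τ'.commutes, map_div₀, hc', div_self hpos.ne']
  obtain ⟨n, ⟨s, hs⟩, hns | hns⟩ := exists_primeCompl_mul_eq_or_mul_eq w z
  · have hn : n ∈ primeOfHom τ := by
      rw [mem_primeOfHom, ← hns, map_mul, map_mul]
      exact mul_lt_one_of_lt_of_le hz (valued_hom_le_one τ s)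
    have hs' : s ∉ primeOfHom τ' := heq ▸ hs
    rw [heq, mem_primeOfHom, ← hns, map_mul, map_mul, hz', one_mul] at hn
    exact hs' (mem_primeOfHom.mpr hn)
  · refine hs (mem_primeOfHom.mpr ?_)
    rw [← hns, map_mul, map_mul]
    exact mul_lt_one_of_lt_of_le hz (valued_hom_le_one τ n)

end IsDedekindDomain.HeightOneSpectrum

namespace NumberField

open UniqueFactorizationMonoid nonZeroDivisors Filter Topology

section IdealPairs

variable {K L : Type*} [Field K] [NumberField K] [Field L] [NumberField L] [Algebra K L]

/-- If every prime of `K` has two distinct primes of `L` of the same norm above it, then pairs of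
nonzero ideals of `K` map injectively to nonzero ideals of `L`, multiplying the norms. -/
lemma exists_injective_absNorm_eq_mul
    (h : ∀ P : Ideal (𝓞 K), P.IsPrime → P ≠ ⊥ → ∃ Q Q' : Ideal (𝓞 L), Q.IsPrime ∧ Q'.IsPrime ∧
      Q.comap (algebraMap (𝓞 K) (𝓞 L)) = P ∧ Q'.comap (algebraMap (𝓞 K) (𝓞 L)) = P ∧
      Q.absNorm = P.absNorm ∧ Q'.absNorm = P.absNorm ∧ Q ≠ Q') :
    ∃ F : (Ideal (𝓞 K))⁰ × (Ideal (𝓞 K))⁰ → (Ideal (𝓞 L))⁰, Function.Injective F ∧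
      ∀ p, (F p : Ideal (𝓞 L)).absNorm =
        (p.1 : Ideal (𝓞 K)).absNorm * (p.2 : Ideal (𝓞 K)).absNorm := by
  classical
  choose! f g hfp hgp hfc hgc hfn hgn hfg using h
  have h_ne_bot (Q : Ideal (𝓞 L)) (P : Ideal (𝓞 K)) (hP : P ≠ ⊥) (hQ : Q.absNorm = P.absNorm) :
      Q ≠ ⊥ := by
    rwa [Ne, ← Ideal.absNorm_eq_zero_iff, hQ, Ideal.absNorm_eq_zero_iff]
  have hmem (I : (Ideal (𝓞 K))⁰) : ∀ P ∈ normalizedFactors (I : Ideal (𝓞 K)),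
      P ∈ {P : Ideal (𝓞 K) | P.IsPrime ∧ P ≠ ⊥} := fun P hP ↦
    ⟨Ideal.isPrime_of_prime (prime_of_normalized_factor P hP),
      ne_zero_of_mem_normalizedFactors hP⟩
  let M (p : (Ideal (𝓞 K))⁰ × (Ideal (𝓞 K))⁰) : Multiset (Ideal (𝓞 L)) :=
    (normalizedFactors (p.1 : Ideal (𝓞 K))).map f + (normalizedFactors (p.2 : Ideal (𝓞 K))).map g
  have hM (p) : ∀ Q ∈ M p, Prime Q := by
    intro Q hQ
    simp only [M, Multiset.mem_add, Multiset.mem_map] at hQ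
    obtain ⟨P, hP, rfl⟩ | ⟨P, hP, rfl⟩ := hQ
    · obtain ⟨h1, h2⟩ := hmem _ P hP
      exact Ideal.prime_of_isPrime (h_ne_bot _ P h2 (hfn P h1 h2)) (hfp P h1 h2)
    · obtain ⟨h1, h2⟩ := hmem _ P hP
      exact Ideal.prime_of_isPrime (h_ne_bot _ P h2 (hgn P h1 h2)) (hgp P h1 h2)
  have hM0 (p) : (M p).prod ≠ 0 := Multiset.prod_ne_zero fun h0 ↦ (hM p 0 h0).ne_zero rfl
  have hprod (I : (Ideal (𝓞 K))⁰) : (normalizedFactors (I : Ideal (𝓞 K))).prod = I :=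
    Ideal.prod_normalizedFactors_eq_self (nonZeroDivisors.coe_ne_zero I)
  refine ⟨fun p ↦ ⟨(M p).prod, mem_nonZeroDivisors_of_ne_zero (hM0 p)⟩, ?_, ?_⟩
  · rintro ⟨I, J⟩ ⟨I', J'⟩ hp
    have hp : M (I, J) = M (I', J') := by
      rw [← normalizedFactors_prod_of_prime (hM (I, J)),
        ← normalizedFactors_prod_of_prime (hM (I', J'))]
      exact congrArg (fun x : (Ideal (𝓞 L))⁰ ↦ normalizedFactors (x : Ideal (𝓞 L))) hp
    obtain ⟨h1, h2⟩ := Multiset.eq_of_map_add_map_eq (r := Ideal.comap (algebraMap (𝓞 K) (𝓞 L)))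
      (fun P hP ↦ hfc P hP.1 hP.2) (fun P hP ↦ hgc P hP.1 hP.2) (fun P hP ↦ hfg P hP.1 hP.2)
      (hmem I) (hmem J) (hmem I') (hmem J') hp
    ext1
    · exact Subtype.ext (by rw [← hprod I, h1, hprod])
    · exact Subtype.ext (by rw [← hprod J, h2, hprod])
  · rintro ⟨I, J⟩
    have hnorm (k : Ideal (𝓞 K) → Ideal (𝓞 L)) (I : (Ideal (𝓞 K))⁰)
        (hk : ∀ P : Ideal (𝓞 K), P.IsPrime → P ≠ ⊥ → (k P).absNorm = P.absNorm) :
        Ideal.absNorm ((normalizedFactors (I : Ideal (𝓞 K))).map k).prod =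
          (I : Ideal (𝓞 K)).absNorm := by
      conv_rhs => rw [← hprod I]
      rw [map_multiset_prod, map_multiset_prod, Multiset.map_map]
      exact congrArg _ (Multiset.map_congr rfl fun P hP ↦ hk P (hmem I P hP).1 (hmem I P hP).2)
    simp only [M, Multiset.prod_add, map_mul]
    rw [hnorm f I hfn, hnorm g J hgn]

end IdealPairs

section Counting

variable (K : Type*) [Field K] [NumberField K]

lemma finite_absNorm_le_real (X : ℝ) :
    {I : (Ideal (𝓞 K))⁰ | (Ideal.absNorm (I : Ideal (𝓞 K)) : ℝ) ≤ X}.Finite :=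
  (Ideal.finite_setOfPred_absNorm_le₀ (S := 𝓞 K) ⌊X⌋₊).subset fun _ hI ↦ Nat.le_floor hI

/-- The sum of the inverses of the norms of the nonzero ideals of `𝓞 K` diverges. -/
lemma not_summable_absNorm_inv :
    ¬ Summable fun I : (Ideal (𝓞 K))⁰ ↦ ((I : Ideal (𝓞 K)).absNorm : ℝ)⁻¹ := by
  classical
  intro hs
  have hκ := dedekindZeta_residue_pos K
  set κ := dedekindZeta_residue K
  obtain ⟨S, hS⟩ := summable_iff_vanishing_norm.mp hs (κ / 2) (by positivity)
  have h1 := NumberField.Ideal.tendsto_norm_le_div_atTop₀ K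
  rw [← dedekindZeta_residue_def] at h1
  have h4 := h1.comp (tendsto_id.const_mul_atTop (show (0 : ℝ) < 4 by norm_num))
  have h5 := h4.sub (h1.div_const 4)
  have hlt : κ / 2 < κ - κ / 4 := by linarith
  obtain ⟨X, hX1, hX2, hX3⟩ := ((h5.eventually_const_lt hlt).and ((eventually_gt_atTop 0).and
    (eventually_ge_atTop (∑ I ∈ S, ((I : Ideal (𝓞 K)).absNorm : ℝ))))).exists
  have hfin (Y : ℝ) := finite_absNorm_le_real K Y
  have hcard (Y : ℝ) : Nat.card {I : (Ideal (𝓞 K))⁰ // ((I : Ideal (𝓞 K)).absNorm : ℝ) ≤ Y} =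
      (hfin Y).toFinset.card := Nat.card_eq_card_finite_toFinset (hfin Y)
  set A := (hfin X).toFinset
  set B := (hfin (4 * X)).toFinset
  have hAB : A ⊆ B := by
    intro I hI
    simp only [A, B, Set.Finite.mem_toFinset, Set.mem_ofPred_eq] at hI ⊢
    linarith
  have hdisj : Disjoint (B \ A) S := by
    refine Finset.disjoint_left.mpr fun I hI hIS ↦ (Finset.mem_sdiff.mp hI).2 ?_
    simp only [A, Set.Finite.mem_toFinset, Set.mem_ofPred_eq]
    exact (Finset.single_le_sum (f := fun I : (Ideal (𝓞 K))⁰ ↦ ((I : Ideal (𝓞 K)).absNorm : ℝ))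
      (fun _ _ ↦ by positivity) hIS).trans hX3
  have hsum := (le_abs_self _).trans_lt (hS _ hdisj)
  have hle : (B \ A).card • (4 * X)⁻¹ ≤ ∑ I ∈ B \ A, ((I : Ideal (𝓞 K)).absNorm : ℝ)⁻¹ := by
    refine Finset.card_nsmul_le_sum _ _ _ fun I hI ↦ ?_
    have h := (Finset.mem_sdiff.mp hI).1
    simp only [B, Set.Finite.mem_toFinset, Set.mem_ofPred_eq] at h
    exact inv_anti₀ (by exact_mod_cast Ideal.absNorm_pos_of_nonZeroDivisors I) h
  rw [nsmul_eq_mul, Finset.cast_card_sdiff hAB] at hle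
  simp only [Function.comp_apply, id, hcard] at hX1
  have : (B.card : ℝ) / (4 * X) - A.card / X / 4 = (B.card - A.card) * (4 * X)⁻¹ := by
    field_simp
  change κ / 2 < (B.card : ℝ) / (4 * X) - A.card / X / 4 at hX1
  linarith

variable {K} {L : Type*} [Field L] [NumberField L]

/-- An injection of pairs of ideals of `K` into the ideals of `L` which multiplies the norms forces
the inverses of the norms of ideals of `K` to be summable, as the ideals of `L` of norm at most `X`
number `O(X)`. -/
lemma summable_absNorm_inv_of_injective
    {F : (Ideal (𝓞 K))⁰ × (Ideal (𝓞 K))⁰ → (Ideal (𝓞 L))⁰} (hF : Function.Injective F)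
    (hN : ∀ p, (F p : Ideal (𝓞 L)).absNorm =
        (p.1 : Ideal (𝓞 K)).absNorm * (p.2 : Ideal (𝓞 K)).absNorm) :
    Summable fun I : (Ideal (𝓞 K))⁰ ↦ ((I : Ideal (𝓞 K)).absNorm : ℝ)⁻¹ := by
  have hK := NumberField.Ideal.tendsto_norm_le_div_atTop₀ K
  have hL := NumberField.Ideal.tendsto_norm_le_div_atTop₀ L
  rw [← dedekindZeta_residue_def] at hK hL
  have hpos (I : (Ideal (𝓞 K))⁰) : (0 : ℝ) < (I : Ideal (𝓞 K)).absNorm := by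
    exact_mod_cast Ideal.absNorm_pos_of_nonZeroDivisors I
  refine summable_of_sum_le (c := dedekindZeta_residue L / dedekindZeta_residue K)
    (fun _ ↦ by positivity) fun S ↦ ?_
  rw [le_div_iff₀ (dedekindZeta_residue_pos K), Finset.sum_mul]
  have hlim := tendsto_finsetSum S fun I _ ↦ (hK.comp
    (tendsto_id.atTop_div_const (hpos I))).const_mul ((I : Ideal (𝓞 K)).absNorm : ℝ)⁻¹
  refine le_of_tendsto_of_tendsto hlim hL ?_
  filter_upwards [eventually_gt_atTop 0] with X hX
  have (Y : ℝ) : Finite {I : (Ideal (𝓞 K))⁰ // ((I : Ideal (𝓞 K)).absNorm : ℝ) ≤ Y} :=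
    finite_absNorm_le_real K Y
  have : Finite {I : (Ideal (𝓞 L))⁰ // ((I : Ideal (𝓞 L)).absNorm : ℝ) ≤ X} :=
    finite_absNorm_le_real L X
  let G : (Σ I : S, {J : (Ideal (𝓞 K))⁰ // ((J : Ideal (𝓞 K)).absNorm : ℝ) ≤
      X / ((I : (Ideal (𝓞 K))⁰) : Ideal (𝓞 K)).absNorm}) →
      {I : (Ideal (𝓞 L))⁰ // ((I : Ideal (𝓞 L)).absNorm : ℝ) ≤ X} := fun p ↦
    ⟨F (p.1, p.2), by
      rw [hN, Nat.cast_mul, mul_comm, ← le_div_iff₀ (hpos _)]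
      exact p.2.2⟩
  have hG : Function.Injective G := by
    rintro ⟨⟨I, hI⟩, J, hJ⟩ ⟨⟨I', hI'⟩, J', hJ'⟩ h
    obtain ⟨rfl, rfl⟩ := Prod.ext_iff.mp (hF (congrArg Subtype.val h))
    rfl
  have hcard := Nat.card_le_card_of_injective G hG
  rw [Nat.card_sigma, Finset.sum_coe_sort S fun I : (Ideal (𝓞 K))⁰ ↦
    Nat.card {J : (Ideal (𝓞 K))⁰ // ((J : Ideal (𝓞 K)).absNorm : ℝ) ≤
      X / (I : Ideal (𝓞 K)).absNorm}] at hcard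
  rw [le_div_iff₀ hX, Finset.sum_mul]
  refine le_trans (le_of_eq ?_) (Nat.cast_le (α := ℝ).mpr hcard)
  rw [Nat.cast_sum]
  refine Finset.sum_congr rfl fun I _ ↦ ?_
  have := hpos I
  simp only [Function.comp_apply, id]
  field_simp

end Counting

/-- If `L / K` is an extension of number fields, there is a finite place `v` of `K` such that `L`
has at most one embedding over `K` in `K_v`. -/
theorem exists_subsingleton_algHom_adicCompletion (K L : Type*) [Field K] [NumberField K] [Field L]
    [NumberField L] [Algebra K L] :
    ∃ v : HeightOneSpectrum (𝓞 K), Subsingleton (L →ₐ[K] v.adicCompletion K) := by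
  by_contra! h
  obtain ⟨F, hF, hN⟩ := exists_injective_absNorm_eq_mul (K := K) (L := L) fun P hP hP0 ↦ by
    obtain ⟨τ, τ', hne⟩ := h ⟨P, hP, hP0⟩
    exact ⟨_, _, inferInstance, inferInstance, HeightOneSpectrum.comap_primeOfHom τ,
      HeightOneSpectrum.comap_primeOfHom τ', HeightOneSpectrum.absNorm_primeOfHom τ,
      HeightOneSpectrum.absNorm_primeOfHom τ', HeightOneSpectrum.primeOfHom_ne_of_ne hne⟩
  exact not_summable_absNorm_inv K (summable_absNorm_inv_of_injective hF hN)

end NumberField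

/-- Let `K` be a number field and `u ∈ Kˣ` not a square in `K`. Then there is
a nonzero prime ideal `v` of `𝓞_K` such that the image of `u` in the completion `K_v` is not
a square in `K_v`. -/
theorem stmt_9 (K : Type*) [Field K] [NumberField K] (u : Kˣ)
    (hu : ¬ IsSquare ((u : K))) :
    ∃ v : HeightOneSpectrum (𝓞 K),
      ¬ IsSquare (algebraMap K (v.adicCompletion K) (u : K)) := by
  by_contra! hsq
  have hirr : Irreducible (Polynomial.X ^ 2 - Polynomial.C (u : K)) := by
    refine X_pow_sub_C_irreducible_of_prime Nat.prime_two fun b hb ↦ hu ⟨b, ?_⟩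
    rw [← hb, sq]
  have hmonic := Polynomial.monic_X_pow_sub_C (u : K) two_ne_zero
  have : Fact (Irreducible (Polynomial.X ^ 2 - Polynomial.C (u : K))) := ⟨hirr⟩
  let L := AdjoinRoot (Polynomial.X ^ 2 - Polynomial.C (u : K))
  have : FiniteDimensional K L := hmonic.finite_adjoinRoot
  have : NumberField L := .of_module_finite K L
  obtain ⟨v, hv⟩ := exists_subsingleton_algHom_adicCompletion K L
  obtain ⟨y, hy⟩ := hsq v
  have hroot (z : v.adicCompletion K) (hz : z * z = y * y) :
      Polynomial.aeval z (Polynomial.X ^ 2 - Polynomial.C (u : K)) = 0 := by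
    rw [map_sub, map_pow, Polynomial.aeval_X, Polynomial.aeval_C, hy, sq, hz, sub_self]
  let τ (z : v.adicCompletion K) (hz : z * z = y * y) : L →ₐ[K] v.adicCompletion K :=
    AdjoinRoot.liftAlgHom _ (Algebra.ofId _ _) z (hroot z hz)
  have hτ (z : v.adicCompletion K) (hz : z * z = y * y) : τ z hz (AdjoinRoot.root _) = z :=
    AdjoinRoot.liftAlgHom_root _ _ _ _
  have hy_neg : y = -y := by
    have h := DFunLike.congr_fun (hv.elim (τ y rfl) (τ (-y) (neg_mul_neg y y)))
      (AdjoinRoot.root _)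
    exact (hτ y rfl).symm.trans (h.trans (hτ (-y) (neg_mul_neg y y)))
  have : CharZero (v.adicCompletion K) :=
    charZero_of_injective_algebraMap (algebraMap K (v.adicCompletion K)).injective
  rw [self_eq_neg.mp hy_neg, mul_zero, map_eq_zero] at hy
  exact u.ne_zero hy
end

section
/- Let K be a number field, let r be a natural number, and let u₁, …, u_r ∈ Kˣ be multiplicatively independent modulo squares, i.e., whenever e₁, …, e_r ∈ {0,1} are such that the product u₁^{e₁}⋯u_r^{e_r} is a square in K, then all e_i = 0. Then there exist nonzero prime ideals v₁, …, v_r of 𝓞_K and group homomorphisms λ_i : (K_{v_i})ˣ → ℤ/2ℤ (from the multiplicative group of the completion to the additive group ℤ/2ℤ) such that the r×r matrix over 𝔽₂ with (i,j)-entry λ_i(image of u_j in K_{v_i}) is invertible; equivalently, the 𝔽₂-linear map sending (e₁,…,e_r) ∈ (ℤ/2ℤ)^r to (Σ_j e_j·λ_i(u_j))_{i=1,…,r} is bijective. -/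
open IsDedekindDomain NumberField

section IdealCounting

open UniqueFactorizationMonoid

variable {R S : Type*} [CommRing R] [IsDedekindDomain R] [CommRing S] [IsDedekindDomain S]

/-- The ideal of `S` obtained from the ideals `I`, `J` of `R` by replacing every prime factor of
`I` by its image under `F`, every prime factor of `J` by its image under `G`, and multiplying. -/
noncomputable def mapFactorsMul (F G : Ideal R → Ideal S) (I J : Ideal R) : Ideal S :=
  ((normalizedFactors I).map F + (normalizedFactors J).map G).prod

lemma mapFactorsMul_injOn [Algebra R S] {F G : Ideal R → Ideal S}
    (hF : ∀ p, Prime p → Prime (F p)) (hG : ∀ p, Prime p → Prime (G p))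
    (hF' : ∀ p, Prime p → (F p).comap (algebraMap R S) = p)
    (hG' : ∀ p, Prime p → (G p).comap (algebraMap R S) = p)
    (hFG : ∀ p, Prime p → F p ≠ G p) {I J I' J' : Ideal R}
    (hI : I ≠ 0) (hJ : J ≠ 0) (hI' : I' ≠ 0) (hJ' : J' ≠ 0)
    (h : mapFactorsMul F G I J = mapFactorsMul F G I' J') : I = I' ∧ J = J' := by
  classical
  have factors_eq (I J : Ideal R) : normalizedFactors (mapFactorsMul F G I J) =
      (normalizedFactors I).map F + (normalizedFactors J).map G := by
    refine normalizedFactors_prod_of_prime fun p hp ↦ ?_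
    simp only [Multiset.mem_add, Multiset.mem_map] at hp
    obtain ⟨q, hq, rfl⟩ | ⟨q, hq, rfl⟩ := hp
    exacts [hF q (prime_of_normalized_factor q hq), hG q (prime_of_normalized_factor q hq)]
  have recover (s t : Multiset (Ideal R)) (hs : ∀ p ∈ s, Prime p) (ht : ∀ p ∈ t, Prime p) :
      ((s.map F + t.map G).filter (fun x ↦ x = F (x.comap (algebraMap R S)))).map
        (Ideal.comap (algebraMap R S)) = s ∧
      ((s.map F + t.map G).filter (fun x ↦ ¬ x = F (x.comap (algebraMap R S)))).map
        (Ideal.comap (algebraMap R S)) = t := by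
    have hsF : ∀ x ∈ s.map F, x = F (x.comap (algebraMap R S)) := by
      simp only [Multiset.mem_map]
      rintro _ ⟨p, hp, rfl⟩
      rw [hF' p (hs p hp)]
    have htG : ∀ x ∈ t.map G, ¬ x = F (x.comap (algebraMap R S)) := by
      simp only [Multiset.mem_map]
      rintro _ ⟨p, hp, rfl⟩
      rw [hG' p (ht p hp)]
      exact (hFG p (ht p hp)).symm
    constructor
    · rw [Multiset.filter_add, Multiset.filter_eq_self.mpr hsF, Multiset.filter_eq_nil.mpr htG,
        add_zero, Multiset.map_map]
      exact (Multiset.map_congr rfl fun p hp ↦ hF' p (hs p hp)).trans (Multiset.map_id _)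
    · rw [Multiset.filter_add, Multiset.filter_eq_self.mpr htG,
        Multiset.filter_eq_nil.mpr fun x hx ↦ not_not.mpr (hsF x hx), zero_add, Multiset.map_map]
      exact (Multiset.map_congr rfl fun p hp ↦ hG' p (ht p hp)).trans (Multiset.map_id _)
  have h' := congrArg normalizedFactors h
  rw [factors_eq, factors_eq] at h'
  have h₁ := recover (normalizedFactors I) (normalizedFactors J) prime_of_normalized_factor
    prime_of_normalized_factor
  have h₂ := recover (normalizedFactors I') (normalizedFactors J') prime_of_normalized_factor
    prime_of_normalized_factor
  rw [h'] at h₁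
  have e₁ := h₁.1.symm.trans h₂.1
  have e₂ := h₁.2.symm.trans h₂.2
  rw [← Ideal.prod_normalizedFactors_eq_self hI, ← Ideal.prod_normalizedFactors_eq_self hJ, e₁, e₂,
    Ideal.prod_normalizedFactors_eq_self hI', Ideal.prod_normalizedFactors_eq_self hJ']
  exact ⟨rfl, rfl⟩

lemma absNorm_mapFactorsMul [Module.Free ℤ R] [Module.Free ℤ S]
    {F G : Ideal R → Ideal S}
    (hF : ∀ p, Prime p → (F p).absNorm = p.absNorm)
    (hG : ∀ p, Prime p → (G p).absNorm = p.absNorm) {I J : Ideal R} (hI : I ≠ 0) (hJ : J ≠ 0) :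
    (mapFactorsMul F G I J).absNorm = I.absNorm * J.absNorm := by
  have key (F : Ideal R → Ideal S) (hF : ∀ p, Prime p → (F p).absNorm = p.absNorm) {I : Ideal R}
      (hI : I ≠ 0) : ((normalizedFactors I).map F).prod.absNorm = I.absNorm := by
    conv_rhs => rw [← Ideal.prod_normalizedFactors_eq_self hI]
    rw [map_multiset_prod, map_multiset_prod, Multiset.map_map]
    exact congrArg _ (Multiset.map_congr rfl fun p hp ↦ hF p (prime_of_normalized_factor p hp))
  rw [mapFactorsMul, Multiset.prod_add, map_mul, key F hF hI, key G hG hJ]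

end IdealCounting

section Zeta

open Filter Topology

/-- If every prime of `K` has two distinct primes of `L` of the same norm above it, then there are
at least as many ideals of `𝓞 L` of norm `n` as pairs of ideals of `𝓞 K` with norms of product
`n`. -/
lemma sum_card_mul_card_le_card {K L : Type*} [Field K] [NumberField K] [Field L] [NumberField L]
    [Algebra K L] {F G : Ideal (𝓞 K) → Ideal (𝓞 L)}
    (hF : ∀ p, Prime p → Prime (F p)) (hG : ∀ p, Prime p → Prime (G p))
    (hF' : ∀ p, Prime p → (F p).comap (algebraMap (𝓞 K) (𝓞 L)) = p)
    (hG' : ∀ p, Prime p → (G p).comap (algebraMap (𝓞 K) (𝓞 L)) = p)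
    (hFn : ∀ p, Prime p → (F p).absNorm = p.absNorm)
    (hGn : ∀ p, Prime p → (G p).absNorm = p.absNorm)
    (hFG : ∀ p, Prime p → F p ≠ G p) (n : ℕ) :
    ∑ d ∈ n.divisorsAntidiagonal, Nat.card {I : Ideal (𝓞 K) // I.absNorm = d.1} *
      Nat.card {I : Ideal (𝓞 K) // I.absNorm = d.2} ≤
      Nat.card {I : Ideal (𝓞 L) // I.absNorm = n} := by
  classical
  have (m : ℕ) : Finite {I : Ideal (𝓞 K) // I.absNorm = m} := Ideal.finite_setOfPred_absNorm_eq m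
  have : Finite {I : Ideal (𝓞 L) // I.absNorm = n} := Ideal.finite_setOfPred_absNorm_eq n
  have hcard : ∑ d ∈ n.divisorsAntidiagonal, Nat.card {I : Ideal (𝓞 K) // I.absNorm = d.1} *
      Nat.card {I : Ideal (𝓞 K) // I.absNorm = d.2} =
      Nat.card (Σ d : n.divisorsAntidiagonal, {I : Ideal (𝓞 K) // I.absNorm = d.1.1} ×
        {I : Ideal (𝓞 K) // I.absNorm = d.1.2}) := by
    rw [Nat.card_sigma, ← Finset.sum_coe_sort]
    simp only [Nat.card_prod]
  rw [hcard]
  have hne {d : ℕ} (hd : d ≠ 0) {I : Ideal (𝓞 K)} (hI : I.absNorm = d) : I ≠ 0 := by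
    rintro rfl
    exact hd (by simpa using hI.symm)
  have hd (d : n.divisorsAntidiagonal) : d.1.1 ≠ 0 ∧ d.1.2 ≠ 0 :=
    Nat.ne_zero_of_mem_divisorsAntidiagonal d.2
  refine Nat.card_le_card_of_injective (fun x ↦ ⟨mapFactorsMul F G x.2.1.1 x.2.2.1, ?_⟩) ?_
  · rw [absNorm_mapFactorsMul hFn hGn (hne (hd _).1 x.2.1.2) (hne (hd _).2 x.2.2.2), x.2.1.2,
      x.2.2.2]
    exact (Nat.mem_divisorsAntidiagonal.mp x.1.2).1
  · rintro ⟨⟨⟨a, b⟩, hab⟩, ⟨I, hI⟩, ⟨J, hJ⟩⟩ ⟨⟨⟨a', b'⟩, hab'⟩, ⟨I', hI'⟩, ⟨J', hJ'⟩⟩ h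
    obtain ⟨rfl, rfl⟩ := mapFactorsMul_injOn hF hG hF' hG' hFG (hne (hd ⟨_, hab⟩).1 hI)
      (hne (hd ⟨_, hab⟩).2 hJ) (hne (hd ⟨_, hab'⟩).1 hI') (hne (hd ⟨_, hab'⟩).2 hJ')
      (Subtype.ext_iff.mp h)
    dsimp only at hI hI' hJ hJ'
    subst hI hJ hI' hJ'
    rfl

lemma dedekindZeta_eventually_summable (K : Type*) [Field K] [NumberField K] :
    ∀ᶠ s : ℝ in 𝓝[>] 1,
      LSeriesSummable (fun n ↦ (Nat.card {I : Ideal (𝓞 K) // I.absNorm = n} : ℂ)) s := by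
  have h := (tendsto_sub_one_mul_dedekindZeta_nhdsGT K).eventually_ne
    (Complex.ofReal_ne_zero.mpr (dedekindZeta_residue_ne_zero K))
  filter_upwards [h] with s hs
  by_contra hns
  exact hs (by rw [dedekindZeta, LSeries, tsum_eq_zero_of_not_summable hns, mul_zero])

/-- An `L`-series with coefficients counting ideals of `L` cannot dominate the square of the one
counting ideals of `K`, since the latter has a double pole at `1`. -/
lemma not_forall_sum_card_mul_card_le_card (K L : Type*) [Field K] [NumberField K] [Field L]
    [NumberField L] :
    ¬ ∀ n : ℕ, ∑ d ∈ n.divisorsAntidiagonal, Nat.card {I : Ideal (𝓞 K) // I.absNorm = d.1} *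
      Nat.card {I : Ideal (𝓞 K) // I.absNorm = d.2} ≤
      Nat.card {I : Ideal (𝓞 L) // I.absNorm = n} := by
  intro hle
  have hK := tendsto_sub_one_mul_dedekindZeta_nhdsGT K
  have hL := tendsto_sub_one_mul_dedekindZeta_nhdsGT L
  have hs0 : Tendsto (fun s : ℝ ↦ ((s : ℂ) - 1)) (𝓝[>] 1) (𝓝 0) := by
    have : Continuous fun s : ℝ ↦ ((s : ℂ) - 1) := by fun_prop
    simpa using (this.tendsto 1).mono_left nhdsWithin_le_nhds
  have hlim₁ := (hK.mul hK).norm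
  have hlim₂ := (hs0.mul hL).norm
  have hbound : ∀ᶠ s : ℝ in 𝓝[>] 1,
      ‖((s : ℂ) - 1) * dedekindZeta K s * (((s : ℂ) - 1) * dedekindZeta K s)‖ ≤
        ‖((s : ℂ) - 1) * (((s : ℂ) - 1) * dedekindZeta L s)‖ := by
    filter_upwards [dedekindZeta_eventually_summable K, dedekindZeta_eventually_summable L]
      with s hsK hsL
    set f : ℕ → ℂ := fun n ↦ (Nat.card {I : Ideal (𝓞 K) // I.absNorm = n} : ℂ) with hf
    set g : ℕ → ℂ := fun n ↦ (Nat.card {I : Ideal (𝓞 L) // I.absNorm = n} : ℂ) with hg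
    have hterm (n : ℕ) : ‖LSeries.term (LSeries.convolution f f) s n‖ ≤ (LSeries.term g s n).re := by
      rcases eq_or_ne n 0 with rfl | hn
      · simp
      have hpow : ((n : ℂ) ^ (s : ℂ)) = ((n : ℝ) ^ s : ℝ) := by
        rw [Complex.ofReal_cpow (Nat.cast_nonneg n)]; simp
      have hpos : 0 < (n : ℝ) ^ s := Real.rpow_pos_of_pos (by positivity) s
      have hconv : (LSeries.convolution f f) n = ((∑ d ∈ n.divisorsAntidiagonal,
          Nat.card {I : Ideal (𝓞 K) // I.absNorm = d.1} *
          Nat.card {I : Ideal (𝓞 K) // I.absNorm = d.2} : ℕ) : ℂ) := by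
        rw [LSeries.convolution_def]
        push_cast
        rfl
      rw [LSeries.term_of_ne_zero hn, LSeries.term_of_ne_zero hn, hconv, hpow, norm_div,
        Complex.norm_natCast, Complex.norm_real, Real.norm_of_nonneg hpos.le, hg,
        Complex.div_ofReal_re, Complex.natCast_re]
      gcongr
      exact hle n
    have hsum : Summable fun n ↦ (LSeries.term g s n).re := (Complex.hasSum_re hsL.hasSum).summable
    have hnorm : ‖dedekindZeta K s * dedekindZeta K s‖ ≤ ‖dedekindZeta L s‖ := by
      rw [dedekindZeta, ← LSeries_convolution' hsK hsK]
      refine (tsum_of_norm_bounded hsum.hasSum hterm).trans ?_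
      rw [← Complex.re_tsum hsL]
      exact Complex.re_le_norm _
    rw [mul_mul_mul_comm, ← mul_assoc ((s : ℂ) - 1) _ (dedekindZeta L s), norm_mul (_ * _) (_ * _),
      norm_mul _ (dedekindZeta L s)]
    gcongr
  have := le_of_tendsto_of_tendsto hlim₁ hlim₂ hbound
  have hpos := dedekindZeta_residue_pos K
  simp only [zero_mul, norm_zero, norm_le_zero_iff, mul_self_eq_zero, Complex.ofReal_eq_zero]
    at this
  exact hpos.ne' this

end Zeta

section LocalEmbedding

variable {K L : Type*} [Field K] [NumberField K] [Field L] [NumberField L] [Algebra K L]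
  {v : HeightOneSpectrum (𝓞 K)}

lemma exists_valued_sub_algebraMap_lt (x : v.adicCompletion K) {y : v.adicCompletion K}
    (hy : y ≠ 0) : ∃ c : K, Valued.v (x - algebraMap K _ c) < Valued.v y := by
  have hnhds : {z : v.adicCompletion K | Valued.v (x - z) < Valued.v y} ∈ nhds x := by
    rw [Valued.mem_nhds]
    refine ⟨Units.mk0 (Valued.v.restrict y) (by simpa using hy), fun z hz ↦ ?_⟩
    simpa [Valuation.map_sub_swap, Valuation.restrict_lt_iff] using hz
  obtain ⟨c, hc⟩ := (HeightOneSpectrum.denseRange_algebraMap K v).exists_mem_open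
    isOpen_interior ⟨x, mem_interior_iff_mem_nhds.mpr hnhds⟩
  have := interior_subset hc
  exact ⟨c, this⟩

lemma valued_algebraMap (c : K) :
    Valued.v (algebraMap K (v.adicCompletion K) c) = v.valuation K c :=
  v.valuedAdicCompletion_eq_valuation' c

omit [NumberField L] in
lemma valued_algHom_le_one (σ : L →ₐ[K] v.adicCompletion K) (x : 𝓞 L) :
    Valued.v (σ x) ≤ 1 := by
  have hx : IsIntegral (𝓞 K) (x : L) := x.isIntegral_coe.tower_top
  have h := hx.map (σ.restrictScalars (𝓞 K))
  have : IsIntegral (v.adicCompletionIntegers K) (σ x) := by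
    obtain ⟨p, hp, hpx⟩ := h
    refine ⟨p.map (algebraMap _ _), hp.map _, ?_⟩
    rw [Polynomial.eval₂_map]
    exact hpx
  obtain ⟨y, hy⟩ := IsIntegrallyClosed.isIntegral_iff.mp this
  rw [← show (y : v.adicCompletion K) = σ x from hy]
  exact y.2

/-- The prime ideal of `𝓞 L` induced by an embedding of `L` into the completion `K_v`. -/
def primeOfAlgHom (σ : L →ₐ[K] v.adicCompletion K) : Ideal (𝓞 L) where
  carrier := {x | Valued.v (σ x) < 1}
  add_mem' {x y} hx hy := by
    simp only [Set.mem_ofPred_eq, map_add] at *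
    exact Valued.v.map_add_lt hx hy
  zero_mem' := by simp
  smul_mem' c x hx := by
    simp only [Set.mem_ofPred_eq, smul_eq_mul, map_mul] at *
    exact mul_lt_one_of_nonneg_of_lt_one_right (valued_algHom_le_one σ c) zero_le hx

omit [NumberField L] in
lemma mem_primeOfAlgHom {σ : L →ₐ[K] v.adicCompletion K} {x : 𝓞 L} :
    x ∈ primeOfAlgHom σ ↔ Valued.v (σ x) < 1 := Iff.rfl

omit [NumberField L] in
lemma comap_primeOfAlgHom (σ : L →ₐ[K] v.adicCompletion K) :
    (primeOfAlgHom σ).comap (algebraMap (𝓞 K) (𝓞 L)) = v.asIdeal := by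
  ext x
  rw [Ideal.mem_comap, mem_primeOfAlgHom, ← v.valuation_lt_one_iff_mem (K := K),
    ← valued_algebraMap, ← σ.commutes]
  rfl

lemma prime_primeOfAlgHom (σ : L →ₐ[K] v.adicCompletion K) : Prime (primeOfAlgHom σ) := by
  refine Ideal.prime_of_isPrime ?_ ⟨?_, fun {x y} hxy ↦ ?_⟩
  · intro h
    refine v.ne_bot ?_
    rw [← comap_primeOfAlgHom σ, h]
    exact Ideal.comap_bot_of_injective _ (FaithfulSMul.algebraMap_injective _ _)
  · rw [Ideal.ne_top_iff_one, mem_primeOfAlgHom]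
    simp
  · simp only [mem_primeOfAlgHom, map_mul] at *
    by_contra! h
    exact absurd hxy (not_lt.mpr (one_le_mul h.1 h.2))

lemma absNorm_primeOfAlgHom (σ : L →ₐ[K] v.adicCompletion K) :
    (primeOfAlgHom σ).absNorm = v.asIdeal.absNorm := by
  rw [Ideal.absNorm_apply, Ideal.absNorm_apply, Submodule.cardQuot_apply, Submodule.cardQuot_apply]
  symm
  refine Nat.card_congr (Equiv.ofBijective (Ideal.quotientMap (primeOfAlgHom σ)
    (algebraMap (𝓞 K) (𝓞 L)) (comap_primeOfAlgHom σ).ge) ⟨?_, ?_⟩)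
  · exact Ideal.quotientMap_injective' (comap_primeOfAlgHom σ).le
  · intro y
    obtain ⟨x, rfl⟩ := Ideal.Quotient.mk_surjective y
    obtain ⟨c, hc⟩ := exists_valued_sub_algebraMap_lt (σ x) (one_ne_zero (α := v.adicCompletion K))
    rw [map_one] at hc
    have hc1 : v.valuation K c ≤ 1 := by
      rw [← valued_algebraMap, ← sub_sub_cancel (σ x) (algebraMap K _ c)]
      exact Valued.v.map_sub_le (valued_algHom_le_one σ x) hc.le
    obtain ⟨a, ha⟩ := v.exists_valuation_sub_lt_of_integer hc1 1
    refine ⟨Ideal.Quotient.mk _ a, ?_⟩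
    rw [Ideal.quotientMap_mk, Ideal.Quotient.eq, mem_primeOfAlgHom]
    have : σ ((algebraMap (𝓞 K) (𝓞 L) a - x : 𝓞 L) : L) =
        algebraMap K _ (algebraMap (𝓞 K) K a - c) - (σ x - algebraMap K _ c) := by
      have : σ ((algebraMap (𝓞 K) (𝓞 L) a : 𝓞 L) : L) = algebraMap K _ (algebraMap (𝓞 K) K a) := by
        rw [← σ.commutes]; rfl
      rw [show ((algebraMap (𝓞 K) (𝓞 L) a - x : 𝓞 L) : L) =
        (algebraMap (𝓞 K) (𝓞 L) a : 𝓞 L) - (x : L) from map_sub (algebraMap (𝓞 L) L) _ _,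
        map_sub, map_sub, this]
      ring
    rw [this]
    refine Valuation.map_sub_lt _ ?_ hc
    rw [valued_algebraMap]
    simpa using ha

lemma valued_lt_one_of_primeOfAlgHom_eq {σ τ : L →ₐ[K] v.adicCompletion K}
    (h : primeOfAlgHom σ = primeOfAlgHom τ) {x : L} (hx : Valued.v (σ x) < 1) :
    Valued.v (τ x) < 1 := by
  have hp := prime_primeOfAlgHom σ
  obtain ⟨P, hP⟩ : ∃ P : HeightOneSpectrum (𝓞 L), P.asIdeal = primeOfAlgHom σ :=
    ⟨⟨primeOfAlgHom σ, Ideal.isPrime_of_prime hp, hp.ne_zero⟩, rfl⟩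
  have unit (σ' : L →ₐ[K] v.adicCompletion K) (h' : primeOfAlgHom σ = primeOfAlgHom σ')
      (d : P.asIdeal.primeCompl) : Valued.v (σ' (d : 𝓞 L)) = 1 := by
    refine le_antisymm (valued_algHom_le_one σ' _) (not_lt.mp fun hd ↦ d.2 ?_)
    exact hP.ge (h'.ge (mem_primeOfAlgHom.mpr hd))
  obtain ⟨n, d, hnd | hnd⟩ := P.exists_primeCompl_mul_eq_or_mul_eq x
  · have hσ := congrArg (fun z ↦ Valued.v (σ z)) hnd
    have hτ := congrArg (fun z ↦ Valued.v (τ z)) hnd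
    simp only [map_mul] at hσ hτ
    rw [show Valued.v (σ (algebraMap (𝓞 L) L d)) = 1 from unit σ rfl d, mul_one] at hσ
    rw [show Valued.v (τ (algebraMap (𝓞 L) L d)) = 1 from unit τ h d, mul_one] at hτ
    rw [hτ]
    rw [hσ] at hx
    exact mem_primeOfAlgHom.mp (h ▸ mem_primeOfAlgHom.mpr hx)
  · have hσ := congrArg (fun z ↦ Valued.v (σ z)) hnd
    simp only [map_mul] at hσ
    rw [show Valued.v (σ (algebraMap (𝓞 L) L d)) = 1 from unit σ rfl d] at hσ
    have := mul_lt_one_of_nonneg_of_lt_one_left zero_le hx (valued_algHom_le_one σ n)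
    exact absurd hσ this.ne

lemma primeOfAlgHom_injective :
    Function.Injective (primeOfAlgHom : (L →ₐ[K] v.adicCompletion K) → Ideal (𝓞 L)) := by
  intro σ τ h
  refine AlgHom.ext fun α ↦ ?_
  by_contra hne
  have hb : σ α - τ α ≠ 0 := sub_ne_zero.mpr hne
  obtain ⟨c, hc⟩ := exists_valued_sub_algebraMap_lt (σ α) hb
  obtain ⟨y, hy⟩ := exists_valued_sub_algebraMap_lt (σ α - τ α) hb
  have hy' : Valued.v (algebraMap K (v.adicCompletion K) y) = Valued.v (σ α - τ α) := by
    rw [← Valuation.map_sub_eq_of_lt_left _ hy, sub_sub_cancel]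
  have hv : 0 < Valued.v (σ α - τ α) := Valuation.pos_iff _ |>.mpr hb
  have h₁ : Valued.v (σ ((α - algebraMap K L c) / algebraMap K L y)) < 1 := by
    rw [map_div₀, map_div₀, map_sub, σ.commutes, σ.commutes, hy']
    exact (div_lt_one₀ hv).mpr hc
  have h₂ := valued_lt_one_of_primeOfAlgHom_eq h h₁
  rw [map_div₀, map_div₀, map_sub, τ.commutes, τ.commutes, hy', div_lt_one₀ hv] at h₂
  have := Valuation.map_sub_lt _ hc h₂
  rw [sub_sub_sub_cancel_right] at this
  exact this.false

end LocalEmbedding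

section LocalGlobal

variable {K : Type*} [Field K] [NumberField K]

/-- A nontrivial extension `L / K` of number fields cannot have two distinct embeddings into every
completion of `K`. -/
lemma exists_subsingleton_algHom (K L : Type*) [Field K] [NumberField K] [Field L] [NumberField L]
    [Algebra K L] : ∃ v : HeightOneSpectrum (𝓞 K), Subsingleton (L →ₐ[K] v.adicCompletion K) := by
  by_contra! h
  choose σ τ hστ using fun v ↦ (h v).exists_pair_ne
  let F (σ : ∀ v : HeightOneSpectrum (𝓞 K), L →ₐ[K] v.adicCompletion K) (p : Ideal (𝓞 K)) :
      Ideal (𝓞 L) :=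
    open Classical in
    if hp : Prime p then primeOfAlgHom (σ ⟨p, Ideal.isPrime_of_prime hp, hp.ne_zero⟩) else ⊥
  have hF σ (p) (hp : Prime p) :
      F σ p = primeOfAlgHom (σ ⟨p, Ideal.isPrime_of_prime hp, hp.ne_zero⟩) := dif_pos hp
  have hprime σ (p) (hp : Prime p) : Prime (F σ p) := hF σ p hp ▸ prime_primeOfAlgHom _
  have hcomap σ (p) (hp : Prime p) : (F σ p).comap (algebraMap (𝓞 K) (𝓞 L)) = p := by
    rw [hF σ p hp, comap_primeOfAlgHom]
  have hnorm σ (p) (hp : Prime p) : (F σ p).absNorm = p.absNorm := by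
    rw [hF σ p hp, absNorm_primeOfAlgHom]
  have hne p (hp : Prime p) : F σ p ≠ F τ p := by
    rw [hF σ p hp, hF τ p hp]
    exact primeOfAlgHom_injective.ne (hστ _)
  exact not_forall_sum_card_mul_card_le_card K L <| sum_card_mul_card_le_card (hprime σ) (hprime τ)
    (hcomap σ) (hcomap τ) (hnorm σ) (hnorm τ) hne

/-- An element of a number field which is not a square is not a square in some completion. -/
lemma exists_not_isSquare_adicCompletion {a : K} (ha : ¬ IsSquare a) :
    ∃ v : HeightOneSpectrum (𝓞 K), ¬ IsSquare (algebraMap K (v.adicCompletion K) a) := by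
  have hirr : Irreducible (Polynomial.X ^ 2 - Polynomial.C a) :=
    X_pow_sub_C_irreducible_of_prime Nat.prime_two fun b hb ↦ ha ⟨b, by rw [← hb, sq]⟩
  have : Fact (Irreducible (Polynomial.X ^ 2 - Polynomial.C a)) := ⟨hirr⟩
  have : FiniteDimensional K (AdjoinRoot (Polynomial.X ^ 2 - Polynomial.C a)) :=
    (AdjoinRoot.powerBasis hirr.ne_zero).finite
  have : CharZero (AdjoinRoot (Polynomial.X ^ 2 - Polynomial.C a)) :=
    charZero_of_injective_algebraMap (algebraMap K _).injective
  have : NumberField (AdjoinRoot (Polynomial.X ^ 2 - Polynomial.C a)) :=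
    NumberField.of_module_finite K _
  obtain ⟨v, hv⟩ := exists_subsingleton_algHom K (AdjoinRoot (Polynomial.X ^ 2 - Polynomial.C a))
  refine ⟨v, fun ⟨b, hb⟩ ↦ ha ?_⟩
  have hroot (c : v.adicCompletion K) (hc : c * c = algebraMap K _ a) :
      (Polynomial.X ^ 2 - Polynomial.C a).eval₂ (Algebra.ofId K (v.adicCompletion K)) c = 0 := by
    simp [Polynomial.eval₂_sub, sq, hc]
  have h := DFunLike.congr_fun (hv.elim
    (AdjoinRoot.liftAlgHom _ (Algebra.ofId K _) b (hroot b hb.symm))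
    (AdjoinRoot.liftAlgHom _ (Algebra.ofId K _) (-b) (hroot (-b) (by rw [neg_mul_neg, hb]))))
    (AdjoinRoot.root _)
  rw [AdjoinRoot.liftAlgHom_root, AdjoinRoot.liftAlgHom_root] at h
  have : CharZero (v.adicCompletion K) :=
    charZero_of_injective_algebraMap (algebraMap K _).injective
  rw [self_eq_neg.mp h, mul_zero, map_eq_zero] at hb
  exact hb ▸ IsSquare.zero

end LocalGlobal

/-- A nonsquare in a commutative group is detected by a homomorphism to `ℤ/2ℤ`. -/
lemma exists_monoidHom_zmod_two_ne_one {G : Type*} [CommGroup G] {x : G} (hx : ¬ IsSquare x) :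
    ∃ f : G →* Multiplicative (ZMod 2), f x ≠ 1 := by
  let H : AddSubgroup (Additive G) := (nsmulAddMonoidHom 2 : Additive G →+ Additive G).range
  let _ : Module (ZMod 2) (Additive G ⧸ H) := AddCommGroup.zmodModule fun y ↦ by
    obtain ⟨y, rfl⟩ := QuotientAddGroup.mk_surjective y
    rw [← QuotientAddGroup.mk_nsmul, QuotientAddGroup.eq_zero_iff]
    exact ⟨y, rfl⟩
  have hx0 : ((Additive.ofMul x : Additive G) : Additive G ⧸ H) ≠ 0 := by
    rw [Ne, QuotientAddGroup.eq_zero_iff]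
    rintro ⟨y, hy⟩
    exact hx ⟨y.toMul, by rw [← sq]; exact hy.symm⟩
  obtain ⟨φ, hφ⟩ := not_forall.mp <|
    (Module.forall_dual_apply_eq_zero_iff (ZMod 2) _).not.mpr hx0
  let f : Additive G →+ ZMod 2 := φ.toAddMonoidHom.comp (QuotientAddGroup.mk' H)
  exact ⟨AddMonoidHom.toMultiplicativeRight f, fun h ↦ hφ (Multiplicative.ofAdd.injective h)⟩

/-- If a set of linear functionals on `Fin r → k` separates points from zero, then `r` of them are
jointly injective. -/
lemma exists_fin_forall_mem_injective {k : Type*} [Field k] {r : ℕ}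
    (Φ : Set (Module.Dual k (Fin r → k))) (hΦ : ∀ e ≠ 0, ∃ φ ∈ Φ, φ e ≠ 0) :
    ∃ f : Fin r → Module.Dual k (Fin r → k), (∀ i, f i ∈ Φ) ∧
      Function.Injective fun e i ↦ f i e := by
  obtain ⟨b, hbΦ, hspan, hli⟩ := exists_linearIndependent k Φ
  have hbot : (Submodule.span k Φ).dualCoannihilator = ⊥ := by
    rw [Submodule.eq_bot_iff]
    intro e he
    by_contra hne
    obtain ⟨φ, hφ, hφe⟩ := hΦ e hne
    exact hφe ((Submodule.mem_dualCoannihilator _).mp he φ (Submodule.subset_span hφ))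
  have htop : Submodule.span k b = ⊤ := by
    rw [hspan, ← Subspace.dualCoannihilator_dualAnnihilator_eq (W := Submodule.span k Φ), hbot,
      Submodule.dualAnnihilator_bot]
  let B := Module.Basis.mk hli (by rw [Subtype.range_coe, htop])
  have : Finite b := Module.Finite.finite_basis B
  have hcard : Nat.card b = r := by
    rw [← Module.finrank_eq_nat_card_basis B, Subspace.dual_finrank_eq, Module.finrank_fin_fun]
  let g := (Finite.equivFinOfCardEq hcard).symm
  refine ⟨fun i ↦ g i, fun i ↦ hbΦ (g i).2, fun e e' h ↦ ?_⟩
  rw [← sub_eq_zero, ← Module.forall_dual_apply_eq_zero_iff k]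
  intro φ
  have hmem : φ ∈ Submodule.span k b := htop ▸ Submodule.mem_top
  induction hmem using Submodule.span_induction with
  | mem ψ hψ =>
    have := congrFun h (g.symm ⟨ψ, hψ⟩)
    simpa [sub_eq_zero] using this
  | zero => simp
  | add ψ₁ ψ₂ _ _ h₁ h₂ => simp [h₁, h₂]
  | smul c ψ _ h => simp [h]

/-- (Linear local certification.) Let `K` be a number field and
`u₁, …, u_r ∈ Kˣ` multiplicatively independent modulo squares. Then there are nonzero primes
`v₁, …, v_r` of `𝓞_K` and group homomorphisms `λᵢ : (K_{vᵢ})ˣ → ℤ/2ℤ` such that the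
`𝔽₂`-linear map `(e₁,…,e_r) ↦ (Σ_j e_j·λᵢ(u_j))ᵢ` is bijective (i.e. the matrix
`(λᵢ(u_j))` is invertible over `𝔽₂`). -/
theorem stmt_10 (K : Type*) [Field K] [NumberField K] (r : ℕ) (u : Fin r → Kˣ)
    (hindep : ∀ e : Fin r → ℕ, (∀ i, e i ≤ 1) →
      IsSquare (∏ i, ((u i : K)) ^ (e i)) → ∀ i, e i = 0) :
    ∃ (v : Fin r → HeightOneSpectrum (𝓞 K))
      (lam : ∀ i : Fin r, ((v i).adicCompletion K)ˣ →* Multiplicative (ZMod 2)),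
      Function.Bijective (fun e : Fin r → ZMod 2 => fun i : Fin r =>
        ∑ j, e j * Multiplicative.toAdd
          ((lam i) (Units.map (algebraMap K ((v i).adicCompletion K)).toMonoidHom (u j)))) := by
  classical
  let ev (v : HeightOneSpectrum (𝓞 K)) (lam : (v.adicCompletion K)ˣ →* Multiplicative (ZMod 2)) :
      Module.Dual (ZMod 2) (Fin r → ZMod 2) :=
    ∑ j, (Multiplicative.toAdd (lam (Units.map
      (algebraMap K (v.adicCompletion K)).toMonoidHom (u j)))) • LinearMap.proj j
  have hev v lam e : ev v lam e = ∑ j, e j * Multiplicative.toAdd (lam (Units.map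
      (algebraMap K (v.adicCompletion K)).toMonoidHom (u j))) := by
    simp [ev, mul_comm]
  obtain ⟨f, hf, hinj⟩ := exists_fin_forall_mem_injective {φ | ∃ v lam, φ = ev v lam} <| by
    intro e he
    have hns : ¬ IsSquare (∏ i, (u i : K) ^ (e i).val) := fun hsq ↦ he <| funext fun i ↦
      (ZMod.val_eq_zero _).mp <| hindep (fun i ↦ (e i).val)
        (fun i ↦ Nat.le_of_lt_succ (ZMod.val_lt (e i))) hsq i
    obtain ⟨v, hv⟩ := exists_not_isSquare_adicCompletion hns
    obtain ⟨lam, hlam⟩ := exists_monoidHom_zmod_two_ne_one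
      (x := Units.map (algebraMap K (v.adicCompletion K)).toMonoidHom (∏ i, u i ^ (e i).val)) <| by
      rintro ⟨y, hy⟩
      refine hv ⟨y, ?_⟩
      simpa using congrArg Units.val hy
    refine ⟨_, ⟨v, lam, rfl⟩, fun h0 ↦ hlam ?_⟩
    rw [hev] at h0
    rw [map_prod, map_prod, ← toAdd_eq_zero, toAdd_prod, ← h0]
    refine Finset.sum_congr rfl fun j _ ↦ ?_
    rw [map_pow, map_pow, toAdd_pow, nsmul_eq_mul, ZMod.natCast_zmod_val]
  choose v lam hvl using hf
  refine ⟨v, lam, Finite.injective_iff_bijective.mp fun e e' h ↦ hinj ?_⟩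
  simpa only [hvl, hev] using h
end

section
/- Let K be the subfield of ℝ generated over ℚ by √2, √133 and √21 (the octic field L⁺ = ℚ(√2, √(7·19), √(7·3)) for the triple (p,q,s) = (7,19,3)), and set Θ = (21070 + 14877·√2 + 1827·√133 + 1290·√266)·(14 + 9·√2 + 3·√21 + 2·√42) ∈ ℝ. Then there exists x ∈ K with x² = Θ; that is, Θ is a square in K, so the residual bit satisfies δ(7,19,3) = 0 and the residual parameter is μ = 1. -/
/-- For `(p,q,s) = (7,19,3)`, in the octic field
`K = ℚ(√2, √133, √21) ⊆ ℝ`, the normalized element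
`Θ = (21070 + 14877√2 + 1827√133 + 1290√266)·(14 + 9√2 + 3√21 + 2√42)` is a square in `K`:
the residual bit is `δ(7,19,3) = 0` and the residual parameter is `μ = 1`. -/
theorem stmt_18 :
    ∃ x ∈ IntermediateField.adjoin ℚ
        ({Real.sqrt 2, Real.sqrt 133, Real.sqrt 21} : Set ℝ),
      x ^ 2 =
        (21070 + 14877 * Real.sqrt 2 + 1827 * Real.sqrt 133 + 1290 * Real.sqrt 266) *
          (14 + 9 * Real.sqrt 2 + 3 * Real.sqrt 21 + 2 * Real.sqrt 42) := by
  have h266 : Real.sqrt 266 = Real.sqrt 2 * Real.sqrt 133 := by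
    rw [← Real.sqrt_mul (by norm_num)]; norm_num
  have h42 : Real.sqrt 42 = Real.sqrt 2 * Real.sqrt 21 := by
    rw [← Real.sqrt_mul (by norm_num)]; norm_num
  have h2 : Real.sqrt 2 ^ 2 = 2 := Real.sq_sqrt (by norm_num)
  have h133 : Real.sqrt 133 ^ 2 = 133 := Real.sq_sqrt (by norm_num)
  have h21 : Real.sqrt 21 ^ 2 = 21 := Real.sq_sqrt (by norm_num)
  rw [h266, h42]
  have m2 : Real.sqrt 2 ∈ IntermediateField.adjoin ℚ
      ({Real.sqrt 2, Real.sqrt 133, Real.sqrt 21} : Set ℝ) :=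
    IntermediateField.subset_adjoin _ _ (by simp)
  have m133 : Real.sqrt 133 ∈ IntermediateField.adjoin ℚ
      ({Real.sqrt 2, Real.sqrt 133, Real.sqrt 21} : Set ℝ) :=
    IntermediateField.subset_adjoin _ _ (by simp)
  have m21 : Real.sqrt 21 ∈ IntermediateField.adjoin ℚ
      ({Real.sqrt 2, Real.sqrt 133, Real.sqrt 21} : Set ℝ) :=
    IntermediateField.subset_adjoin _ _ (by simp)
  generalize IntermediateField.adjoin ℚ
    ({Real.sqrt 2, Real.sqrt 133, Real.sqrt 21} : Set ℝ) = K at m2 m133 m21 ⊢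
  generalize Real.sqrt 2 = a at *
  generalize Real.sqrt 133 = b at *
  generalize Real.sqrt 21 = c at *
  -- Here `√57 = √133 * √21 / 7`.
  let u : K := ⟨a, m2⟩
  let v : K := ⟨b, m133⟩
  let w : K := ⟨c, m21⟩
  refine ⟨_, ((519 + 369 * u + 45 * v + 32 * (u * v) + 117 * w + 84 * (u * w)
    + 71 / 7 * (v * w) + 51 / 7 * (u * v * w)) / 2 : K).2, ?_⟩
  have key : (((519 + 369 * u + 45 * v + 32 * (u * v) + 117 * w + 84 * (u * w)
      + 71 / 7 * (v * w) + 51 / 7 * (u * v * w)) / 2 : K) : ℝ) =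
      (519 + 369 * a + 45 * b + 32 * (a * b) + 117 * c + 84 * (a * c)
      + 71 / 7 * (b * c) + 51 / 7 * (a * b * c)) / 2 := by
    push_cast
    rfl
  rw [key]
  grind
end

section
/- Let K be the subfield of ℝ generated over ℚ by √2, √21 and √413 (the octic field L⁺ = ℚ(√2, √(7·3), √(7·59)) for the triple (p,q,s) = (7,3,59)), let ε₂₁ = 55 + 12·√21, and set Θ = (14 + 9·√2 + 3·√21 + 2·√42)·(79375590 + 56126523·√2 + 3905783·√413 + 2761830·√826) ∈ ℝ. Then there is no x ∈ K with x² = Θ, but there exists x ∈ K with x² = ε₂₁·Θ; that is, Θ is not a square in K while ε₂₁·Θ is, so the residual bit satisfies δ(7,3,59) = 1 and the residual parameter is μ = ε₂₁. -/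
open IntermediateField in
theorem exists_eq_add_mul_of_mem_adjoin_insert {S : Set ℝ} {s : ℝ} {d : ℚ} (hs : s ^ 2 = d)
    (hsS : s ∉ adjoin ℚ S) {x : ℝ} (hx : x ∈ adjoin ℚ (insert s S)) :
    ∃ u ∈ adjoin ℚ S, ∃ v ∈ adjoin ℚ S, x = u + v * s := by
  have hd : (d : ℝ) ∈ adjoin ℚ S := (adjoin ℚ S).algebraMap_mem d
  induction hx using adjoin_induction with
  | mem x hx =>
    rcases hx with rfl | hx
    · exact ⟨0, zero_mem _, 1, one_mem _, by ring⟩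
    · exact ⟨x, subset_adjoin ℚ S hx, 0, zero_mem _, by ring⟩
  | algebraMap q => exact ⟨algebraMap ℚ ℝ q, (adjoin ℚ S).algebraMap_mem q, 0, zero_mem _, by ring⟩
  | add x y _ _ ihx ihy =>
    obtain ⟨u, hu, v, hv, rfl⟩ := ihx
    obtain ⟨u', hu', v', hv', rfl⟩ := ihy
    exact ⟨u + u', add_mem hu hu', v + v', add_mem hv hv', by ring⟩
  | mul x y _ _ ihx ihy =>
    obtain ⟨u, hu, v, hv, rfl⟩ := ihx
    obtain ⟨u', hu', v', hv', rfl⟩ := ihy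
    exact ⟨u * u' + v * v' * d, add_mem (mul_mem hu hu') (mul_mem (mul_mem hv hv') hd),
      u * v' + v * u', add_mem (mul_mem hu hv') (mul_mem hv hu'),
      by linear_combination v * v' * hs⟩
  | inv x _ ih =>
    obtain ⟨u, hu, v, hv, rfl⟩ := ih
    have key : ∀ w ∈ adjoin ℚ S, ∀ z ∈ adjoin ℚ S, w = z * s → z = 0 := by
      intro w hw z hz h
      by_contra hz0
      exact hsS ((eq_div_of_mul_eq hz0 (by rw [h]; ring) : s = w / z) ▸ div_mem hw hz)
    rcases eq_or_ne (u + v * s) 0 with h0 | h0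
    · exact ⟨0, zero_mem _, 0, zero_mem _, by rw [h0]; simp⟩
    have h1 : u - v * s ≠ 0 := by
      intro h
      have hv0 := key u hu v hv (by linarith)
      subst hv0
      apply h0
      linarith
    have hN : u ^ 2 - v ^ 2 * d ≠ 0 := by
      rw [show u ^ 2 - v ^ 2 * d = (u + v * s) * (u - v * s) by linear_combination v ^ 2 * hs]
      exact mul_ne_zero h0 h1
    have hNm : u ^ 2 - v ^ 2 * d ∈ adjoin ℚ S :=
      sub_mem (pow_mem hu 2) (mul_mem (pow_mem hv 2) hd)
    refine ⟨u / (u ^ 2 - v ^ 2 * d), div_mem hu hNm, -v / (u ^ 2 - v ^ 2 * d),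
      div_mem (neg_mem hv) hNm, ?_⟩
    apply inv_eq_of_mul_eq_one_right
    field_simp
    linear_combination -v ^ 2 * hs

open IntermediateField in
/-- A rational number that becomes a square on adjoining `√d` is a square up to a factor `d`. -/
theorem exists_sq_or_exists_sq_mul_of_adjoin_insert {S : Set ℝ} {s : ℝ} {d q : ℚ}
    (hs : s ^ 2 = d) (h : ∃ x ∈ adjoin ℚ (insert s S), x ^ 2 = (q : ℝ)) :
    (∃ x ∈ adjoin ℚ S, x ^ 2 = (q : ℝ)) ∨ ∃ x ∈ adjoin ℚ S, x ^ 2 = ((q * d : ℚ) : ℝ) := by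
  obtain ⟨x, hx, hxq⟩ := h
  by_cases hsS : s ∈ adjoin ℚ S
  · have hle : adjoin ℚ (insert s S) ≤ adjoin ℚ S :=
      adjoin_le_iff.2 (Set.insert_subset hsS (subset_adjoin ℚ S))
    exact .inl ⟨x, hle hx, hxq⟩
  obtain ⟨u, hu, v, hv, rfl⟩ := exists_eq_add_mul_of_mem_adjoin_insert hs hsS hx
  have hd : (d : ℝ) ∈ adjoin ℚ S := (adjoin ℚ S).algebraMap_mem d
  have hq : (q : ℝ) ∈ adjoin ℚ S := (adjoin ℚ S).algebraMap_mem q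
  by_cases hv0 : v = 0
  · exact .inl ⟨u, hu, by rw [← hxq, hv0]; ring⟩
  by_cases hu0 : u = 0
  · refine .inr ⟨v * d, mul_mem hv hd, ?_⟩
    subst hu0
    push_cast
    rw [← hxq, ← hs]
    ring
  refine absurd ?_ hsS
  have h2 : (2 : ℝ) ∈ adjoin ℚ S := ofNat_mem _ 2
  have : s = (q - u ^ 2 - v ^ 2 * d) / (2 * u * v) := by
    field_simp
    linear_combination hxq - v ^ 2 * hs
  rw [this]
  exact div_mem (sub_mem (sub_mem hq (pow_mem hu 2)) (mul_mem (pow_mem hv 2) hd))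
    (mul_mem (mul_mem h2 hu) hv)

open IntermediateField in
theorem isSquare_of_exists_sq_mem_adjoin_empty {q : ℚ}
    (h : ∃ x ∈ adjoin ℚ (∅ : Set ℝ), x ^ 2 = (q : ℝ)) : IsSquare q := by
  obtain ⟨x, hx, hxq⟩ := h
  rw [adjoin_empty, mem_bot] at hx
  obtain ⟨r, rfl⟩ := hx
  refine ⟨r, ?_⟩
  rw [eq_ratCast] at hxq
  rw [← sq]
  exact_mod_cast hxq.symm

open IntermediateField in
theorem not_exists_sq_eq_seven :
    ¬ ∃ x ∈ adjoin ℚ ({Real.sqrt 2, Real.sqrt 21, Real.sqrt 413} : Set ℝ), x ^ 2 = 7 := by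
  intro h
  have h' : ∃ x ∈ adjoin ℚ (insert (Real.sqrt 2) (insert (Real.sqrt 21)
      (insert (Real.sqrt 413) ∅)) : Set ℝ), x ^ 2 = ((7 : ℚ) : ℝ) := by
    simpa using h
  have ha : Real.sqrt 2 ^ 2 = ((2 : ℚ) : ℝ) := by norm_num
  have hb : Real.sqrt 21 ^ 2 = ((21 : ℚ) : ℝ) := by norm_num
  have hc : Real.sqrt 413 ^ 2 = ((413 : ℚ) : ℝ) := by norm_num
  rcases exists_sq_or_exists_sq_mul_of_adjoin_insert ha h' with h | h <;>
  rcases exists_sq_or_exists_sq_mul_of_adjoin_insert hb h with h | h <;>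
  rcases exists_sq_or_exists_sq_mul_of_adjoin_insert hc h with h | h <;>
  · have := isSquare_of_exists_sq_mem_adjoin_empty h
    norm_num at this


/-- For `(p,q,s) = (7,3,59)`, in the octic field
`K = ℚ(√2, √21, √413) ⊆ ℝ`, the normalized element
`Θ = (14 + 9√2 + 3√21 + 2√42)·(79375590 + 56126523√2 + 3905783√413 + 2761830√826)` is not a
square in `K`, but `ε₂₁·Θ = (55 + 12√21)·Θ` is: the residual bit is `δ(7,3,59) = 1` and the
residual parameter is `μ = ε₂₁`. -/
theorem stmt_19 :
    (¬ ∃ x ∈ IntermediateField.adjoin ℚ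
        ({Real.sqrt 2, Real.sqrt 21, Real.sqrt 413} : Set ℝ),
      x ^ 2 =
        (14 + 9 * Real.sqrt 2 + 3 * Real.sqrt 21 + 2 * Real.sqrt 42) *
          (79375590 + 56126523 * Real.sqrt 2 + 3905783 * Real.sqrt 413 +
            2761830 * Real.sqrt 826)) ∧
    (∃ x ∈ IntermediateField.adjoin ℚ
        ({Real.sqrt 2, Real.sqrt 21, Real.sqrt 413} : Set ℝ),
      x ^ 2 =
        (55 + 12 * Real.sqrt 21) *
          ((14 + 9 * Real.sqrt 2 + 3 * Real.sqrt 21 + 2 * Real.sqrt 42) *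
            (79375590 + 56126523 * Real.sqrt 2 + 3905783 * Real.sqrt 413 +
              2761830 * Real.sqrt 826))) := by
  have hab : Real.sqrt 42 = Real.sqrt 2 * Real.sqrt 21 := by
    rw [← Real.sqrt_mul (by norm_num)]; norm_num
  have hac : Real.sqrt 826 = Real.sqrt 2 * Real.sqrt 413 := by
    rw [← Real.sqrt_mul (by norm_num)]; norm_num
  have hpos : 0 < (14 + 9 * Real.sqrt 2 + 3 * Real.sqrt 21 + 2 * Real.sqrt 42) *
      (79375590 + 56126523 * Real.sqrt 2 + 3905783 * Real.sqrt 413 +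
        2761830 * Real.sqrt 826) := by positivity
  have ha : Real.sqrt 2 ^ 2 = 2 := Real.sq_sqrt (by norm_num)
  have hb : Real.sqrt 21 ^ 2 = 21 := Real.sq_sqrt (by norm_num)
  have hc : Real.sqrt 413 ^ 2 = 413 := Real.sq_sqrt (by norm_num)
  set K := IntermediateField.adjoin ℚ
    ({Real.sqrt 2, Real.sqrt 21, Real.sqrt 413} : Set ℝ) with hK
  have haK : Real.sqrt 2 ∈ K := IntermediateField.subset_adjoin _ _ (by simp)
  have hbK : Real.sqrt 21 ∈ K := IntermediateField.subset_adjoin _ _ (by simp)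
  have hcK : Real.sqrt 413 ∈ K := IntermediateField.subset_adjoin _ _ (by simp)
  have hy : ∃ y ∈ K, y ^ 2 = (55 + 12 * Real.sqrt 21) *
      ((14 + 9 * Real.sqrt 2 + 3 * Real.sqrt 21 + 2 * Real.sqrt 42) *
        (79375590 + 56126523 * Real.sqrt 2 + 3905783 * Real.sqrt 413 +
          2761830 * Real.sqrt 826)) := by
    rw [hab, hac]
    generalize Real.sqrt 2 = a at *
    generalize Real.sqrt 21 = b at *
    generalize Real.sqrt 413 = c at *
    refine ⟨(2389233 + 1690829 * a + 521549 * b + 117663 * c + 369096 * (a * b) +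
      83132 * (a * c) + 25685 * (b * c) + 18147 * (a * b * c)) / 14, ?_, ?_⟩
    · repeat' first
        | assumption | exact ofNat_mem K _ | apply div_mem | apply add_mem | apply mul_mem
    · linear_combination ((-52785562331/4) + (67200236) * c + (-5867436906) * b + (337632345/14) * b * c +
          (35259844) * c^2 + (107756886/7) * b * c^2 + (-651976056) * b^2 +
          (14440068/7) * b^2 * c + (329313609/196) * b^2 * c^2) * ha +
        ((-11094600359/4) + (2957935/14) * c + (-1961266440) * a + (2091801/14) * a * c +
          (1318346443/196) * c^2 + (466105695/98) * a * c^2) * hb +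
        ((1976846990/7) + (123252387/2) * b + (2795682873/14) * a + (87152569/2) * a * b) * hc
  refine ⟨?_, hy⟩
  rintro ⟨x, hx, hxθ⟩
  obtain ⟨y, hyK, hyθ⟩ := hy
  rw [← hxθ] at hyθ hpos
  refine not_exists_sq_eq_seven ⟨7 * (y / x) / (14 + 3 * Real.sqrt 21), ?_, ?_⟩
  · exact div_mem (mul_mem (ofNat_mem K 7) (div_mem hyK hx))
      (add_mem (ofNat_mem K 14) (mul_mem (ofNat_mem K 3) hbK))
  · have hx0 : x ≠ 0 := by rintro rfl; simp at hpos
    have hden : 14 + 3 * Real.sqrt 21 ≠ 0 := by positivity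
    field_simp
    linear_combination 7 * hyθ - 9 * x ^ 2 * hb
end
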